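/- arXiv:1804.04782 — 2 statements merged into one kernel-verified Lean document; each statement's English description precedes it below -/
import Mathlib

section
/- Let θ₁, θ₂ ∈ ℂ and let I ⊂ ℝ be an open interval with 0 ∉ I. Suppose λ, μ : I → ℂ are differentiable functions satisfying the Hamiltonian system of the third Painlevé equation: t·λ'(t) = 2λ(t)²μ(t) + 2θ₁λ(t) + t and t·μ'(t) = −(2λ(t)μ(t)² + 2θ₁μ(t) − θ₂ − λ(t)/2) for all t ∈ I. Define h(t) = λ(t)²μ(t)² + (2θ₁λ(t) + t)μ(t) − θ₂λ(t) − λ(t)²/4 + θ₁². Then h is twice differentiable on I and satisfies the σ-form of Painlevé III: (t·h''(t))² − (4·h'(t)² − 1)·(h(t) − t·h'(t)) + 4θ₁θ₂·h'(t) − θ₁² − θ₂² = 0 for all t ∈ I. -/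
/-- Let `θ₁, θ₂ ∈ ℂ` and let `I = (a, b)` be an open interval with
`0 ∉ I`.  If `λ, μ : I → ℂ` solve the Hamiltonian system of the third Painlevé equation
`t·λ' = 2λ²μ + 2θ₁λ + t`, `t·μ' = -(2λμ² + 2θ₁μ - θ₂ - λ/2)`, then
`h(t) = λ²μ² + (2θ₁λ + t)μ - θ₂λ - λ²/4 + θ₁²` is twice differentiable on `I` and
satisfies the σ-form of Painlevé III:
`(t h'')² - (4(h')² - 1)(h - t h') + 4θ₁θ₂ h' - θ₁² - θ₂² = 0`. -/
theorem statement17 (θ₁ θ₂ : ℂ) (a b : ℝ) (h0 : (0 : ℝ) ∉ Set.Ioo a b)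
    (lam mu : ℝ → ℂ)
    (hsys : ∀ t ∈ Set.Ioo a b, ∃ dl dm : ℂ,
      HasDerivAt lam dl t ∧ HasDerivAt mu dm t ∧
      (t : ℂ) * dl = 2 * lam t ^ 2 * mu t + 2 * θ₁ * lam t + (t : ℂ) ∧
      (t : ℂ) * dm = -(2 * lam t * mu t ^ 2 + 2 * θ₁ * mu t - θ₂ - lam t / 2)) :
    ∃ h' h'' : ℝ → ℂ,
      (∀ t ∈ Set.Ioo a b,
        HasDerivAt (fun s : ℝ =>
          lam s ^ 2 * mu s ^ 2 + (2 * θ₁ * lam s + (s : ℂ)) * mu s - θ₂ * lam s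
            - lam s ^ 2 / 4 + θ₁ ^ 2) (h' t) t) ∧
      (∀ t ∈ Set.Ioo a b, HasDerivAt h' (h'' t) t) ∧
      ∀ t ∈ Set.Ioo a b,
        ((t : ℂ) * h'' t) ^ 2
          - (4 * (h' t) ^ 2 - 1) *
            ((lam t ^ 2 * mu t ^ 2 + (2 * θ₁ * lam t + (t : ℂ)) * mu t - θ₂ * lam t
              - lam t ^ 2 / 4 + θ₁ ^ 2) - (t : ℂ) * h' t)
          + 4 * θ₁ * θ₂ * h' t - θ₁ ^ 2 - θ₂ ^ 2 = 0 := by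
  have ht0 : ∀ t ∈ Set.Ioo a b, (t : ℂ) ≠ 0 := fun t ht h =>
    h0 (Complex.ofReal_eq_zero.mp h ▸ ht)
  -- The flow is Hamiltonian, so `h' = ∂h/∂t = μ`.
  refine ⟨mu, deriv mu, fun t ht => ?_, fun t ht => ?_, fun t ht => ?_⟩ <;>
    obtain ⟨dl, dm, hl, hm, el, em⟩ := hsys t ht
  · have hid : HasDerivAt (fun s : ℝ => (s : ℂ)) 1 t := Complex.ofRealCLM.hasDerivAt
    have hderiv := ((((((hl.pow 2).mul (hm.pow 2)).add
      (((hl.const_mul (2 * θ₁)).add hid).mul hm)).sub (hl.const_mul θ₂)).sub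
      ((hl.pow 2).div_const 4)).add_const (θ₁ ^ 2))
    refine hderiv.congr_deriv (mul_left_cancel₀ (ht0 t ht) ?_)
    simp only [Pi.pow_apply, Pi.add_apply]
    push_cast
    linear_combination
      (2 * lam t * mu t ^ 2 + 2 * θ₁ * mu t - θ₂ - lam t / 2) * el
        + (2 * lam t ^ 2 * mu t + 2 * θ₁ * lam t + (t : ℂ)) * em
  · exact hm.differentiableAt.hasDerivAt
  · rw [hm.deriv, em]
    ring
end

section
/- Let θ ∈ ℂ and let I ⊂ ℝ be an open interval. Suppose λ, μ : I → ℂ are differentiable functions satisfying the Hamiltonian system of the second Painlevé equation: λ'(t) = μ(t) − λ(t)² − t/2 and μ'(t) = 2λ(t)μ(t) + θ/2 for all t ∈ I. Define σ(t) = μ(t)²/2 − (λ(t)² + t/2)μ(t) − (θ/2)λ(t). Then σ is twice differentiable on I with σ'(t) = −μ(t)/2, and satisfies the σ-form of Painlevé II: (σ''(t))² − 2σ'(t)·(σ(t) − t·σ'(t)) + 4(σ'(t))³ − θ²/16 = 0 for all t ∈ I. -/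
/-- Let `θ ∈ ℂ` and let `I = (a, b)` be an open interval.  If
`λ, μ : I → ℂ` solve the Hamiltonian system of the second Painlevé equation
`λ' = μ - λ² - t/2`, `μ' = 2λμ + θ/2`, then
`σ(t) = μ²/2 - (λ² + t/2)μ - (θ/2)λ` is twice differentiable on `I` with `σ' = -μ/2`,
and satisfies the σ-form of Painlevé II:
`(σ'')² - 2σ'(σ - tσ') + 4(σ')³ - θ²/16 = 0`. -/
theorem statement19 (θ : ℂ) (a b : ℝ) (lam mu : ℝ → ℂ)
    (hlam : ∀ t ∈ Set.Ioo a b, HasDerivAt lam (mu t - lam t ^ 2 - (t : ℂ) / 2) t)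
    (hmu : ∀ t ∈ Set.Ioo a b, HasDerivAt mu (2 * lam t * mu t + θ / 2) t) :
    (∀ t ∈ Set.Ioo a b,
      HasDerivAt (fun s : ℝ =>
        mu s ^ 2 / 2 - (lam s ^ 2 + (s : ℂ) / 2) * mu s - (θ / 2) * lam s)
        (-(mu t) / 2) t) ∧
    ∃ s2 : ℝ → ℂ,
      (∀ t ∈ Set.Ioo a b, HasDerivAt (fun u : ℝ => -(mu u) / 2) (s2 t) t) ∧
      ∀ t ∈ Set.Ioo a b,
        (s2 t) ^ 2
          - 2 * (-(mu t) / 2) *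
            ((mu t ^ 2 / 2 - (lam t ^ 2 + (t : ℂ) / 2) * mu t - (θ / 2) * lam t)
              - (t : ℂ) * (-(mu t) / 2))
          + 4 * (-(mu t) / 2) ^ 3 - θ ^ 2 / 16 = 0 := by
  refine ⟨fun t ht => ?_, fun t => -(2 * lam t * mu t + θ / 2) / 2, fun t ht => ?_,
    fun t _ => by ring⟩
  · have hl := hlam t ht
    have hm := hmu t ht
    have hid : HasDerivAt (fun s : ℝ => (s : ℂ)) 1 t := (hasDerivAt_id t).ofReal_comp
    refine ((((hm.fun_pow 2).div_const 2).fun_sub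
      (((hl.fun_pow 2).fun_add (hid.div_const 2)).fun_mul hm)).fun_sub
      (hl.const_mul (θ / 2))).congr_deriv ?_
    push_cast
    ring
  · exact (hmu t ht).fun_neg.div_const 2
end
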